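/- Let M be a monoid acting trivially on the right on a pointed set S (so s·m = s for all s and m), pointed at pt. Then the reduced universal monoid U[S//M] of the pointed action category S//M is isomorphic, as a monoid, to the coproduct (free product) of the family of copies of M indexed by the elements of S other than pt. -/

import Mathlib

open CategoryTheory

/-- A right action of a monoid `M` on a type `X`. -/
class RightAction (M X : Type) [Monoid M] where
  act : X → M → X
  act_one : ∀ x : X, act x 1 = x
  act_mul : ∀ (x : X) (m k : M), act (act x m) k = act x (m * k)

/-- The action category `X // M` of a right action of a monoid `M` on `X`:
objects are the elements of `X`, and a morphism `x ⟶ y` is an element `m : M`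
with `y = x · m`. -/
structure ActionCat (M X : Type) [Monoid M] [RightAction M X] where
  obj : X

instance (M X : Type) [Monoid M] [RightAction M X] : Category (ActionCat M X) where
  Hom a b := { m : M // RightAction.act a.obj m = b.obj }
  id a := ⟨1, RightAction.act_one a.obj⟩
  comp f g := ⟨f.1 * g.1, by rw [← RightAction.act_mul, f.2, g.2]⟩
  id_comp f := Subtype.ext (one_mul _)
  comp_id f := Subtype.ext (mul_one _)
  assoc f g h := Subtype.ext (mul_assoc _ _ _)



/-- The set of all morphisms of a small category `C`. -/
abbrev Mor (C : Type) [SmallCategory C] : Type := Σ x y : C, x ⟶ y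

/-- The generating relations for the universal monoid `U(C)` on a small category `C`:
the identity `id_x` of each object is related to `1`, and the composite `g ∘ f` of a
composable pair `f : x → y`, `g : y → z` is related to the product `f·g`. -/
def uRel (C : Type) [SmallCategory C] :
    FreeMonoid (Mor C) → FreeMonoid (Mor C) → Prop := fun a b =>
  (∃ x : C, a = FreeMonoid.of ⟨x, x, 𝟙 x⟩ ∧ b = 1) ∨
  (∃ (x y z : C) (f : x ⟶ y) (g : y ⟶ z),
    a = FreeMonoid.of ⟨x, z, f ≫ g⟩ ∧
    b = FreeMonoid.of ⟨x, y, f⟩ * FreeMonoid.of ⟨y, z, g⟩)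

/-- The universal monoid `U(C)` of a small category `C`: the quotient of the free
monoid on the set of all morphisms of `C` by the monoid congruence generated by the
relations `id_x ~ 1` and `(g ∘ f) ~ f·g`. -/
abbrev UMon (C : Type) [SmallCategory C] : Type := (conGen (uRel C)).Quotient

/-- The class `⟦f⟧` in `U(C)` of a morphism `f` of `C`. -/
def UMon.mk {C : Type} [SmallCategory C] {x y : C} (f : x ⟶ y) : UMon C :=
  (conGen (uRel C)).mk' (FreeMonoid.of ⟨x, y, f⟩)

/-- The generating relations for the reduced universal monoid `U[C]` of a pointed
category `(C, pt)`: in addition to the relations of `U(C)`, every endomorphism of the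
basepoint `pt` is related to `1`. -/
def uRedRel (C : Type) [SmallCategory C] (pt : C) :
    FreeMonoid (Mor C) → FreeMonoid (Mor C) → Prop := fun a b =>
  uRel C a b ∨ (∃ e : pt ⟶ pt, a = FreeMonoid.of ⟨pt, pt, e⟩ ∧ b = 1)

/-- The reduced universal monoid `U[C]` of a pointed category `(C, pt)`: the quotient
of the free monoid on the morphisms of `C` by the monoid congruence generated by the
relations `id_x ~ 1`, `(g ∘ f) ~ f·g`, and `e ~ 1` for every endomorphism `e` of `pt`. -/
abbrev URed (C : Type) [SmallCategory C] (pt : C) : Type := (conGen (uRedRel C pt)).Quotient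

/-- The class `⟦f⟧` in `U[C]` of a morphism `f` of `C`. -/
def URed.mk {C : Type} [SmallCategory C] (pt : C) {x y : C} (f : x ⟶ y) : URed C pt :=
  (conGen (uRedRel C pt)).mk' (FreeMonoid.of ⟨x, y, f⟩)

namespace URed

variable {C : Type} [SmallCategory C] {pt : C}

theorem mk_id (x : C) : URed.mk pt (𝟙 x) = 1 :=
  (Con.eq _).2 (ConGen.Rel.of _ _ (Or.inl (Or.inl ⟨x, rfl, rfl⟩)))

theorem mk_comp {x y z : C} (f : x ⟶ y) (g : y ⟶ z) :
    URed.mk pt (f ≫ g) = URed.mk pt f * URed.mk pt g :=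
  (Con.eq _).2 (ConGen.Rel.of _ _ (Or.inl (Or.inr ⟨x, y, z, f, g, rfl, rfl⟩)))

theorem mk_end (e : pt ⟶ pt) : URed.mk pt e = 1 :=
  (Con.eq _).2 (ConGen.Rel.of _ _ (Or.inr ⟨e, rfl, rfl⟩))

/-- The universal property of `U[C]`: a function on morphisms that respects the defining
relations extends to a monoid homomorphism. -/
def lift {N : Type*} [Monoid N] (φ : ∀ {x y : C}, (x ⟶ y) → N)
    (map_id : ∀ x : C, φ (𝟙 x) = 1)
    (map_comp : ∀ (x y z : C) (f : x ⟶ y) (g : y ⟶ z), φ (f ≫ g) = φ f * φ g)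
    (map_end : ∀ e : pt ⟶ pt, φ e = 1) : URed C pt →* N :=
  (conGen (uRedRel C pt)).lift (FreeMonoid.lift fun f : Mor C => φ f.2.2) <| by
    refine Con.conGen_le.2 ?_
    rintro _ _ ((⟨x, rfl, rfl⟩ | ⟨x, y, z, f, g, rfl, rfl⟩) | ⟨e, rfl, rfl⟩)
    · simpa [Con.ker_rel] using map_id x
    · simpa [Con.ker_rel] using map_comp x y z f g
    · simpa [Con.ker_rel] using map_end e

theorem lift_mk {N : Type*} [Monoid N] (φ : ∀ {x y : C}, (x ⟶ y) → N)
    (map_id : ∀ x : C, φ (𝟙 x) = 1)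
    (map_comp : ∀ (x y z : C) (f : x ⟶ y) (g : y ⟶ z), φ (f ≫ g) = φ f * φ g)
    (map_end : ∀ e : pt ⟶ pt, φ e = 1) {x y : C} (f : x ⟶ y) :
    lift φ map_id map_comp map_end (URed.mk pt f) = φ f := by
  simp [lift, URed.mk]

theorem hom_ext {N : Type*} [Monoid N] {F G : URed C pt →* N}
    (h : ∀ {x y : C} (f : x ⟶ y), F (URed.mk pt f) = G (URed.mk pt f)) : F = G :=
  Con.hom_ext <| FreeMonoid.hom_eq fun f => h f.2.2

end URed

open Classical in
/-- The inclusion of the copy of `M` indexed by `s` into the free product over `S ∖ {pt}`,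
which is trivial for `s = pt`. -/
noncomputable def coprodInclusion {S : Type} (M : Type) [Monoid M] (pt s : S) :
    M →* Monoid.CoprodI fun _ : {s : S // s ≠ pt} => M :=
  if h : s = pt then 1
  else Monoid.CoprodI.of (M := fun _ : {s : S // s ≠ pt} => M) (i := ⟨s, h⟩)

theorem coprodInclusion_self {M S : Type} [Monoid M] (pt : S) : coprodInclusion M pt pt = 1 :=
  dif_pos rfl

theorem coprodInclusion_of_ne {M S : Type} [Monoid M] {pt s : S} (h : s ≠ pt) :
    coprodInclusion M pt s =
      Monoid.CoprodI.of (M := fun _ : {s : S // s ≠ pt} => M) (i := ⟨s, h⟩) :=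
  dif_neg h

section TrivialAction

variable {M S : Type} [Monoid M] [RightAction M S]

/-- For a trivial action, every `m : M` is an endomorphism of every object of `S // M`. -/
def ActionCat.endo (htriv : ∀ (s : S) (m : M), RightAction.act s m = s) (s : S) (m : M) :
    (⟨s⟩ : ActionCat M S) ⟶ ⟨s⟩ :=
  show { m : M // RightAction.act s m = s } from ⟨m, htriv s m⟩

/-- For a trivial action, each `s : S` gives a homomorphism `M →* U[S // M]` sending `m` to the
class of the endomorphism `m` of `s`. -/
def URed.ofEnd (htriv : ∀ (s : S) (m : M), RightAction.act s m = s) (pt s : S) :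
    M →* URed (ActionCat M S) ⟨pt⟩ where
  toFun m := URed.mk ⟨pt⟩ (ActionCat.endo htriv s m)
  map_one' := URed.mk_id (⟨s⟩ : ActionCat M S)
  map_mul' m k := URed.mk_comp (ActionCat.endo htriv s m) (ActionCat.endo htriv s k)

/-- The homomorphism from `U[S // M]` to the free product induced by `coprodInclusion`. -/
noncomputable def URed.toCoprodI (htriv : ∀ (s : S) (m : M), RightAction.act s m = s) (pt : S) :
    URed (ActionCat M S) ⟨pt⟩ →* Monoid.CoprodI fun _ : {s : S // s ≠ pt} => M :=
  URed.lift (fun {x _} f => coprodInclusion M pt x.obj f.1)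
    (fun x => map_one (coprodInclusion M pt x.obj))
    (fun x y _ f g => by
      obtain ⟨x⟩ := x
      obtain ⟨y⟩ := y
      obtain rfl : x = y := (htriv x f.1).symm.trans f.2
      exact map_mul (coprodInclusion M pt x) f.1 g.1)
    (fun e => by rw [coprodInclusion_self]; rfl)

theorem URed.toCoprodI_mk (htriv : ∀ (s : S) (m : M), RightAction.act s m = s) (pt : S)
    {x y : ActionCat M S} (f : x ⟶ y) :
    URed.toCoprodI htriv pt (URed.mk ⟨pt⟩ f) = coprodInclusion M pt x.obj f.1 :=
  URed.lift_mk ..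

end TrivialAction

/-- Let `M` be a monoid acting trivially on the right on a pointed type `S` (so
`s · m = s` for all `s` and `m`), pointed at `pt`.  Then the reduced universal monoid
`U[S // M]` of the pointed action category `S // M` is isomorphic, as a monoid, to the
coproduct (free product) of the family of copies of `M` indexed by the elements of `S`
other than `pt`. -/
theorem uRed_trivialAction_iso_coprodI (M S : Type) [Monoid M] [RightAction M S]
    (htriv : ∀ (s : S) (m : M), RightAction.act s m = s) (pt : S) :
    Nonempty (URed (ActionCat M S) ⟨pt⟩ ≃*
      Monoid.CoprodI fun _ : {s : S // s ≠ pt} => M) := by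
  refine ⟨MonoidHom.toMulEquiv (URed.toCoprodI htriv pt)
    (Monoid.CoprodI.lift fun s => URed.ofEnd htriv pt s.1) ?_ ?_⟩
  · refine URed.hom_ext fun {x y} f => ?_
    obtain ⟨x⟩ := x
    obtain ⟨y⟩ := y
    obtain ⟨m, hm⟩ := f
    obtain rfl : x = y := (htriv x m).symm.trans hm
    rw [MonoidHom.comp_apply, URed.toCoprodI_mk, MonoidHom.id_apply]
    by_cases h : x = pt
    · subst h
      rw [coprodInclusion_self, MonoidHom.one_apply, map_one]
      exact (URed.mk_end _).symm
    · rw [coprodInclusion_of_ne h, Monoid.CoprodI.lift_of]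
      rfl
  · refine Monoid.CoprodI.ext_hom _ _ fun s => MonoidHom.ext fun m => ?_
    simp only [MonoidHom.comp_apply, MonoidHom.id_apply, Monoid.CoprodI.lift_of]
    refine (URed.toCoprodI_mk htriv pt _).trans ?_
    rw [coprodInclusion_of_ne s.2]
    rfl
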